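/- arXiv:2507.10133 — 3 statements merged into one kernel-verified Lean document; each statement's English description precedes it below -/
import Mathlib

section
/- None of the converses of the supra-classicality properties hold in general. Specifically: (i) there exist a vocabulary (P, S), an SPSS M over it, a precisification π ∈ Π, s ∈ S, and p ∈ P with M, π ⊩ ⊡_s p and M, π ⊮ □_s p; (ii) there exist an SPSS M, π ∈ Π, s ∈ S, and q ∈ P with M, π ⊩ ◇_s q and M, π ⊮ ⟐_s q; (iii) there exist an SPSS M, π ∈ Π, and s, t ∈ S with M, π ⊩ s ≲ t and M, π ⊮ s ≤ t; (iv) there exist an SPSS M, π ∈ Π, and p, q ∈ P with M, π ⊩ p ⤳ ¬q and M, π ⊮ p → ¬q. -/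
/-- Standpoint expressions over a set `S` of standpoint symbols:
`e ::= * | s | -e | e ∩ e`. -/
inductive SE (S : Type) : Type where
  | star : SE S
  | atom : S → SE S
  | compl : SE S → SE S
  | inter : SE S → SE S → SE S

/-- `e ∪ d := -(-e ∩ -d)` -/
def SE.union {S : Type} (e d : SE S) : SE S := .compl (.inter (.compl e) (.compl d))

/-- `e \ d := e ∩ -d` -/
def SE.diff {S : Type} (e d : SE S) : SE S := .inter e (.compl d)

/-- Formulas of the language L:
`α ::= ⊤ | p | e ≲ d | ¬α | α ∧ α | □_e α | ⊡_e α | α ⤳ α`. -/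
inductive Fml (P S : Type) : Type where
  | top : Fml P S
  | atom : P → Fml P S
  | dsharp : SE S → SE S → Fml P S   -- e ≲ d
  | neg : Fml P S → Fml P S
  | and : Fml P S → Fml P S → Fml P S
  | box : SE S → Fml P S → Fml P S   -- □_e α
  | dbox : SE S → Fml P S → Fml P S  -- ⊡_e α
  | dimp : Fml P S → Fml P S → Fml P S  -- α ⤳ β

def Fml.bot {P S : Type} : Fml P S := .neg .top
def Fml.or {P S : Type} (a b : Fml P S) : Fml P S := .neg (.and (.neg a) (.neg b))
def Fml.imp {P S : Type} (a b : Fml P S) : Fml P S := Fml.or (.neg a) b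
/-- `◇_e α := ¬□_e ¬α` -/
def Fml.dia {P S : Type} (e : SE S) (a : Fml P S) : Fml P S := .neg (.box e (.neg a))
/-- `⟐_e α := ¬⊡_e ¬α` -/
def Fml.ddia {P S : Type} (e : SE S) (a : Fml P S) : Fml P S := .neg (.dbox e (.neg a))
/-- `e ≤ d := □_{e \ d} ⊥` -/
def Fml.sharp {P S : Type} (e d : SE S) : Fml P S := .box (SE.diff e d) Fml.bot

/-- A state-preferential standpoint structure (SPSS) with precisifications
drawn from the type `W`. -/
structure SPSS (P S W : Type) : Type where
  nonempty : Nonempty W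
  σ : SE S → Set W
  σ_star : σ .star = Set.univ
  σ_inter : ∀ e d, σ (.inter e d) = σ e ∩ σ d
  σ_compl : ∀ e, σ (.compl e) = (σ e)ᶜ
  σ_atom : ∀ s : S, (σ (.atom s)).Nonempty
  γ : W → Set P
  prec : W → W → Prop
  prec_irrefl : ∀ w, ¬ prec w w
  prec_trans : ∀ a b c, prec a b → prec b c → prec a c
  prec_wf : ∀ (X : Set W), ∀ π ∈ X,
      (∀ π' ∈ X, ¬ prec π' π) ∨
        ∃ π' ∈ X, (∀ π'' ∈ X, ¬ prec π'' π') ∧ prec π' π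

/-- `min_≺ X` : the set of ≺-minimal elements of `X`. -/
def SPSS.minOf {P S W : Type} (M : SPSS P S W) (X : Set W) : Set W :=
  {π ∈ X | ∀ π' ∈ X, ¬ M.prec π' π}

/-- Satisfaction `M, π ⊩ α`. -/
def SPSS.sat {P S W : Type} (M : SPSS P S W) : W → Fml P S → Prop
  | _, .top => True
  | π, .atom p => p ∈ M.γ π
  | _, .dsharp e d => M.minOf (M.σ e) ⊆ M.σ d
  | π, .neg a => ¬ M.sat π a
  | π, .and a b => M.sat π a ∧ M.sat π b
  | _, .box e a => ∀ π' ∈ M.σ e, M.sat π' a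
  | _, .dbox e a => ∀ π' ∈ M.minOf (M.σ e), M.sat π' a
  | π, .dimp a b => π ∉ M.minOf {π' | M.sat π' a} ∨ M.sat π b

/-- `⟦α⟧^M` -/
def SPSS.states {P S W : Type} (M : SPSS P S W) (a : Fml P S) : Set W :=
  {π | M.sat π a}

/-- `M ⊩ α` : global satisfaction. -/
def SPSS.gsat {P S W : Type} (M : SPSS P S W) (a : Fml P S) : Prop :=
  ∀ π : W, M.sat π a

/-- Conjunction `⋀K` of a finite knowledge base (given as a list). -/
def listConj {P S : Type} : List (Fml P S) → Fml P S
  | [] => .top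
  | a :: rest => .and a (listConj rest)

/-- The extension of a standpoint expression determined by the extensions of the symbols. -/
def SE.interp {S W : Type} (v : S → Set W) : SE S → Set W
  | .star => Set.univ
  | .atom s => v s
  | .compl e => (e.interp v)ᶜ
  | .inter e d => e.interp v ∩ d.interp v

/-- The two-point chain `false ≺ true`, where the standpoint symbol `true` denotes both points,
the symbol `false` denotes only the minimal one, and each set of points is an atom naming itself. -/
def boolChain : SPSS (Set Bool) Bool Bool where
  nonempty := ⟨false⟩
  σ := SE.interp fun s => {w | w ≤ s}
  σ_star := rfl
  σ_inter _ _ := rfl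
  σ_compl _ := rfl
  σ_atom s := ⟨s, le_refl s⟩
  γ w := {A | w ∈ A}
  prec := (· < ·)
  prec_irrefl := lt_irrefl
  prec_trans _ _ _ := lt_trans
  prec_wf X π hπ := by
    by_cases h : false ∈ X <;> cases π <;> simp_all

/-- None of the converses of the supra-classicality properties hold in general. -/
theorem supra_classicality_converses_fail :
    (∃ (P S : Type), Finite S ∧ Nonempty S ∧ ∃ (W : Type) (M : SPSS P S W)
      (π : W) (s : S) (p : P),
        M.sat π (.dbox (.atom s) (.atom p)) ∧ ¬ M.sat π (.box (.atom s) (.atom p))) ∧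
    (∃ (P S : Type), Finite S ∧ Nonempty S ∧ ∃ (W : Type) (M : SPSS P S W)
      (π : W) (s : S) (q : P),
        M.sat π (Fml.dia (.atom s) (.atom q)) ∧ ¬ M.sat π (Fml.ddia (.atom s) (.atom q))) ∧
    (∃ (P S : Type), Finite S ∧ Nonempty S ∧ ∃ (W : Type) (M : SPSS P S W)
      (π : W) (s t : S),
        M.sat π (.dsharp (.atom s) (.atom t)) ∧ ¬ M.sat π (Fml.sharp (.atom s) (.atom t))) ∧
    (∃ (P S : Type), Finite S ∧ Nonempty S ∧ ∃ (W : Type) (M : SPSS P S W)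
      (π : W) (p q : P),
        M.sat π (.dimp (.atom p) (.neg (.atom q))) ∧
        ¬ M.sat π (Fml.imp (.atom p) (.neg (.atom q)))) := by
  refine ⟨⟨_, _, inferInstance, inferInstance, _, boolChain, true, true, {false}, ?_⟩,
    ⟨_, _, inferInstance, inferInstance, _, boolChain, true, true, {true}, ?_⟩,
    ⟨_, _, inferInstance, inferInstance, _, boolChain, true, true, false, ?_⟩,
    ⟨_, _, inferInstance, inferInstance, _, boolChain, true, Set.univ, {true}, ?_⟩⟩ <;>
  simp [SPSS.sat, SPSS.minOf, Fml.dia, Fml.ddia, Fml.sharp, Fml.imp, Fml.or, Fml.bot, SE.diff,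
    SE.interp, boolChain]
end

section
/- The converses of the union properties of the defeasible modalities fail in general: there exist a vocabulary (P, S), an SPSS M over it, standpoint symbols s, t ∈ S, and an atom p ∈ P such that M ⊩ ⊡_{s ∪ t} p but M ⊮ ⊡_s p, and such that M ⊩ ⟐_s ¬p ∨ ⟐_t ¬p but M ⊮ ⟐_{s ∪ t} ¬p. -/
/-- The extension of a standpoint expression determined by the extensions of the symbols. -/
def SE.eval {S W : Type} (v : S → Set W) : SE S → Set W
  | .star => Set.univ
  | .atom s => v s
  | .compl e => (e.eval v)ᶜ
  | .inter e d => e.eval v ∩ d.eval v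

/-- Two precisifications with `true ≺ false`, each the only one of its own standpoint;
the single atom holds exactly at `true`. -/
def twoPointSPSS : SPSS Unit Bool Bool where
  nonempty := ⟨true⟩
  σ := SE.eval fun b => {b}
  σ_star := rfl
  σ_inter _ _ := rfl
  σ_compl _ := rfl
  σ_atom s := ⟨s, rfl⟩
  γ w := {_p | w = true}
  prec a b := a = true ∧ b = false
  prec_irrefl := by simp
  prec_trans := by simp
  prec_wf X w hw := by
    by_cases h : true ∈ X <;> cases w <;> simp_all

theorem twoPointSPSS_minOf_atom (b : Bool) :
    twoPointSPSS.minOf (twoPointSPSS.σ (.atom b)) = {b} := by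
  ext w
  cases b <;> cases w <;> simp [SPSS.minOf, twoPointSPSS, SE.eval]

theorem twoPointSPSS_minOf_union :
    twoPointSPSS.minOf (twoPointSPSS.σ (SE.union (.atom false) (.atom true))) = {true} := by
  ext w
  cases w <;> simp [SPSS.minOf, twoPointSPSS, SE.eval, SE.union]

theorem mem_twoPointSPSS_γ (w : Bool) (p : Unit) :
    p ∈ twoPointSPSS.γ w ↔ w = true := Iff.rfl

/-- The converses of the union properties of the defeasible modalities fail in general. -/
theorem union_properties_converses_fail :
    ∃ (P S : Type), Finite S ∧ Nonempty S ∧ ∃ (W : Type) (M : SPSS P S W)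
      (s t : S) (p : P),
        M.gsat (.dbox (SE.union (.atom s) (.atom t)) (.atom p)) ∧
        ¬ M.gsat (.dbox (.atom s) (.atom p)) ∧
        M.gsat (Fml.or (Fml.ddia (.atom s) (.neg (.atom p)))
                        (Fml.ddia (.atom t) (.neg (.atom p)))) ∧
        ¬ M.gsat (Fml.ddia (SE.union (.atom s) (.atom t)) (.neg (.atom p))) := by
  refine ⟨Unit, Bool, inferInstance, inferInstance, Bool, twoPointSPSS, false, true, (),
    ?_, ?_, ?_, ?_⟩ <;>
  simp [SPSS.gsat, SPSS.sat, Fml.or, Fml.ddia, twoPointSPSS_minOf_atom,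
    twoPointSPSS_minOf_union, mem_twoPointSPSS_γ]
end

section
/- (Cautious Monotonicity.) For every SPSS M = (Π, σ, γ, ≺), every precisification π ∈ Π, and all standpoint expressions e, d, g ∈ E: if M, π ⊩ e ≲ d and M, π ⊩ e ≲ g, then M, π ⊩ (e ∩ g) ≲ d. -/
/-- If every minimal element of `X` lies in `Y`, minimal elements of `X ∩ Y` are minimal in `X`. -/
theorem SPSS.minOf_inter_subset_minOf {P S W : Type} (M : SPSS P S W) {X Y : Set W}
    (h : M.minOf X ⊆ Y) : M.minOf (X ∩ Y) ⊆ M.minOf X := by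
  rintro w ⟨⟨hX, hY⟩, hmin⟩
  rcases M.prec_wf X w hX with hw | ⟨v, hv, hvmin, hvw⟩
  · exact ⟨hX, hw⟩
  · exact absurd hvw (hmin v ⟨hv, h ⟨hv, hvmin⟩⟩)

/-- Cautious Monotonicity for defeasible sharpenings. -/
theorem dsharp_cm {P S : Type} [Finite S] [Nonempty S] {W : Type}
    (M : SPSS P S W) (π : W) (e d g : SE S)
    (h1 : M.sat π (.dsharp e d)) (h2 : M.sat π (.dsharp e g)) :
    M.sat π (.dsharp (.inter e g) d) := by
  simp only [SPSS.sat, M.σ_inter] at *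
  exact (M.minOf_inter_subset_minOf h2).trans h1
end
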